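/- arXiv:1007.0069 — 2 statements merged into one kernel-verified Lean document; each statement's English description precedes it below -/
import Mathlib

section
/- Let p ∈ ℤ[X] be a polynomial such that, regarding p as an element of ℤ⟦X⟧, substituting Y for the variable gives subst Y (p : ℤ⟦X⟧) = −(p : ℤ⟦X⟧) (i.e. p(x̄) = −p(x)). Then p = 0. (This is the key step in the proof of the Proposition that no finite relations exist among the elements of the generating set 𝒢₂ of KO*(BT^m): a finite relation for m = 1 would produce such a polynomial.) -/
/-- The power series `Y = −X + X² − X³ + ⋯ ∈ ℤ⟦X⟧`, the conjugate `x̄ = −x/(1+x)`. -/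
noncomputable def Y : PowerSeries ℤ :=
  PowerSeries.mk fun n => if n = 0 then 0 else (-1) ^ n

/-- Substitution of `Y` (which has zero constant term) into a formal power series:
the coefficient of `X^n` in `f(Y)` is `∑_{k ≤ n} (coeff k f) · coeff n (Y^k)`,
which is the standard substitution formula (the sum is finite since `Y` has order `≥ 1`). -/
noncomputable def substY (f : PowerSeries ℤ) : PowerSeries ℤ :=
  PowerSeries.mk fun n =>
    ∑ k ∈ Finset.range (n + 1), PowerSeries.coeff k f * PowerSeries.coeff n (Y ^ k)

theorem Y_mul_one_add_X : Y * (1 + PowerSeries.X) = -PowerSeries.X := by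
  ext n
  rcases n with _ | _ | n
  · simp [Y, mul_add]
  · simp [Y, mul_add, PowerSeries.coeff_succ_mul_X]
  · simp [Y, mul_add, PowerSeries.coeff_succ_mul_X, PowerSeries.coeff_X, pow_succ]

theorem coeff_Y_pow_eq_zero {n k : ℕ} (h : n < k) : PowerSeries.coeff n (Y ^ k) = 0 := by
  have hX : PowerSeries.X ∣ Y := by
    rw [PowerSeries.X_dvd_iff]
    rw [← PowerSeries.coeff_zero_eq_constantCoeff_apply, Y, PowerSeries.coeff_mk, if_pos rfl]
  exact PowerSeries.X_pow_dvd_iff.1 (pow_dvd_pow_of_dvd hX k) n h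

theorem substY_coe (p : Polynomial ℤ) :
    substY (p : PowerSeries ℤ) =
      ∑ k ∈ Finset.range (p.natDegree + 1), PowerSeries.C (p.coeff k) * Y ^ k := by
  ext n
  simp only [substY, PowerSeries.coeff_mk, map_sum, PowerSeries.coeff_C_mul,
    Polynomial.coeff_coe]
  rcases le_total n p.natDegree with hn | hn
  · refine Finset.sum_subset (Finset.range_mono (by lia)) fun k _ hk => ?_
    rw [coeff_Y_pow_eq_zero (by simpa using hk), mul_zero]
  · refine (Finset.sum_subset (Finset.range_mono (by lia)) fun k _ hk => ?_).symm
    rw [Polynomial.coeff_eq_zero_of_natDegree_lt (by simpa using hk), zero_mul]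

/-- Multiplying `p(Y)` by `(1 + X) ^ deg p` clears denominators. -/
theorem substY_coe_mul_one_add_X_pow (p : Polynomial ℤ) :
    substY (p : PowerSeries ℤ) * (1 + PowerSeries.X) ^ p.natDegree =
      ((∑ k ∈ Finset.range (p.natDegree + 1), Polynomial.C (p.coeff k) *
        ((-Polynomial.X) ^ k * (1 + Polynomial.X) ^ (p.natDegree - k)) : Polynomial ℤ) :
        PowerSeries ℤ) := by
  rw [substY_coe, Finset.sum_mul, ← Polynomial.coeToPowerSeries.ringHom_apply, map_sum]
  refine Finset.sum_congr rfl fun k hk => ?_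
  have hk' : k ≤ p.natDegree := by simpa [Nat.lt_succ_iff] using hk
  simp only [map_mul, map_pow, map_neg, map_add, map_one,
    Polynomial.coeToPowerSeries.ringHom_apply, Polynomial.coe_C, Polynomial.coe_X]
  rw [← Y_mul_one_add_X, mul_pow, mul_assoc (Y ^ k), ← pow_add, Nat.add_sub_cancel' hk',
    mul_assoc]

/-- No finite relations: if a polynomial `p` satisfies `p(x̄) = −p(x)` then `p = 0`. -/
theorem no_finite_relation (p : Polynomial ℤ)
    (h : substY (p : PowerSeries ℤ) = -(p : PowerSeries ℤ)) : p = 0 := by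
  have key := substY_coe_mul_one_add_X_pow p
  rw [h] at key
  have hpoly : -p * (1 + Polynomial.X) ^ p.natDegree =
      ∑ k ∈ Finset.range (p.natDegree + 1), Polynomial.C (p.coeff k) *
        ((-Polynomial.X) ^ k * (1 + Polynomial.X) ^ (p.natDegree - k)) := by
    apply Polynomial.coe_injective ℤ
    rw [← key]
    simp only [← Polynomial.coeToPowerSeries.ringHom_apply, map_mul, map_pow, map_neg, map_add,
      map_one]
    simp
  have hev := congrArg (Polynomial.eval (-1)) hpoly
  rw [Polynomial.eval_finsetSum, Finset.sum_range_succ, Finset.sum_eq_zero] at hev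
  · rw [← Polynomial.leadingCoeff_eq_zero, Polynomial.leadingCoeff]
    rcases Nat.eq_zero_or_pos p.natDegree with h0 | hpos
    · rw [Polynomial.eq_C_of_natDegree_eq_zero h0] at hev ⊢
      simp at hev ⊢
      lia
    · simpa [hpos.ne'] using hev.symm
  · intro k hk
    have hk' : p.natDegree - k ≠ 0 := by
      have := Finset.mem_range.1 hk
      lia
    simp [hk']
end

section
/- Let θ ∈ ℤ⟦X⟧ be a formal power series and p ∈ ℤ[X] a polynomial such that θ − subst Y θ = (p : ℤ⟦X⟧), i.e. θ(x) − θ(x̄) = p(x). Then p = 0. (This is the assertion, in the proof of the Proposition that no finite relations exist among the elements of 𝒢₂, that no nonzero polynomial relation r(p(x₁)) = 0 can occur in KO⁰(ℂP^∞): by the Bott exact sequence such a relation would yield a power series θ with θ(x) − θ(x̄) = p(x), and it is checked that no such relation can occur in KU⁰(ℂP^∞).) -/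
open PowerSeries in
theorem one_add_X_mul_Y : (1 + X : PowerSeries ℤ) * Y = -X := by
  ext n
  rcases n with _ | _ | n
  · simp [Y]
  · simp [Y, add_mul, coeff_succ_X_mul]
  · simp [Y, add_mul, coeff_succ_X_mul, coeff_X, pow_succ]

theorem hasSubst_Y : PowerSeries.HasSubst Y :=
  PowerSeries.HasSubst.of_constantCoeff_zero'
    (by simp [Y, ← PowerSeries.coeff_zero_eq_constantCoeff_apply])

theorem substY_eq_subst (f : PowerSeries ℤ) : substY f = f.subst Y := by
  ext n
  rw [PowerSeries.coeff_subst' hasSubst_Y, substY, PowerSeries.coeff_mk]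
  symm
  simp only [smul_eq_mul]
  apply finsum_eq_sum_of_support_subset
  intro k hk
  by_contra hkn
  apply hk
  have hX : (PowerSeries.X : PowerSeries ℤ) ∣ Y :=
    PowerSeries.X_dvd_iff.2 (by simp [Y, ← PowerSeries.coeff_zero_eq_constantCoeff_apply])
  have hn : n < k := by simpa using hkn
  simp [PowerSeries.X_pow_dvd_iff.1 (pow_dvd_pow_of_dvd hX k) n hn]

theorem Y_subst_Y : Y.subst Y = (PowerSeries.X : PowerSeries ℤ) := by
  have h := congrArg (PowerSeries.substAlgHom (R := ℤ) hasSubst_Y) one_add_X_mul_Y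
  rw [map_mul, map_add, map_one, map_neg, PowerSeries.substAlgHom_X,
    PowerSeries.coe_substAlgHom] at h
  linear_combination (1 + PowerSeries.X) * h - (PowerSeries.subst Y Y + 1) * one_add_X_mul_Y

theorem substY_substY (f : PowerSeries ℤ) : substY (substY f) = f := by
  rw [substY_eq_subst, substY_eq_subst,
    PowerSeries.subst_comp_subst_apply hasSubst_Y hasSubst_Y, Y_subst_Y, PowerSeries.X_subst]

/-- Clearing denominators in `p(−X/(1+X))`. -/
theorem one_add_X_pow_mul_substY_coe (p : Polynomial ℤ) :
    (1 + PowerSeries.X) ^ p.natDegree * substY p =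
      ((∑ k ∈ Finset.range (p.natDegree + 1), Polynomial.C (p.coeff k) *
        ((-Polynomial.X) ^ k * (1 + Polynomial.X) ^ (p.natDegree - k)) : Polynomial ℤ) :
        PowerSeries ℤ) := by
  rw [substY_eq_subst, PowerSeries.subst_coe hasSubst_Y, Polynomial.aeval_eq_sum_range,
    Finset.mul_sum, ← Polynomial.coeToPowerSeries.ringHom_apply, map_sum]
  refine Finset.sum_congr rfl fun k hk => ?_
  have hk' : k ≤ p.natDegree := by simpa [Nat.lt_succ_iff] using hk
  simp only [map_mul, map_pow, map_neg, map_add, map_one,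
    Polynomial.coeToPowerSeries.ringHom_apply, Polynomial.coe_X, Polynomial.coe_C]
  rw [← one_add_X_mul_Y, mul_pow, PowerSeries.smul_eq_C_mul]
  conv_lhs => rw [← Nat.add_sub_cancel' hk', pow_add]
  ring

/-- If a power series `θ` and a polynomial `p` satisfy `θ(x) − θ(x̄) = p(x)`,
then `p = 0`. -/
theorem no_polynomial_difference (θ : PowerSeries ℤ) (p : Polynomial ℤ)
    (h : θ - substY θ = (p : PowerSeries ℤ)) : p = 0 := by
  have hp : substY p = -(p : PowerSeries ℤ) := by
    rw [← h, substY_eq_subst, PowerSeries.subst_sub hasSubst_Y, ← substY_eq_subst,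
      ← substY_eq_subst, substY_substY]
    ring
  have key := one_add_X_pow_mul_substY_coe p
  rw [hp] at key
  have hpoly : (1 + Polynomial.X) ^ p.natDegree * -p =
      ∑ k ∈ Finset.range (p.natDegree + 1), Polynomial.C (p.coeff k) *
        ((-Polynomial.X) ^ k * (1 + Polynomial.X) ^ (p.natDegree - k)) := by
    apply Polynomial.coe_injective ℤ
    rw [← key]
    simp only [← Polynomial.coeToPowerSeries.ringHom_apply, map_mul, map_pow, map_add, map_one,
      map_neg]
    simp
  have heval := congrArg (Polynomial.eval (-1)) hpoly
  rw [Polynomial.eval_finsetSum, Finset.sum_range_succ, Finset.sum_eq_zero] at heval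
  · rcases Nat.eq_zero_or_pos p.natDegree with hd | hd
    · rw [Polynomial.eq_C_of_natDegree_eq_zero hd] at heval ⊢
      simp at heval ⊢
      lia
    · rw [← Polynomial.leadingCoeff_eq_zero]
      simpa [hd.ne'] using heval.symm
  · intro k hk
    have : p.natDegree - k ≠ 0 := by have := Finset.mem_range.1 hk; lia
    simp [this]
end
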